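/- arXiv:1201.2829 — 3 statements merged into one kernel-verified Lean document; each statement's English description precedes it below -/
import Mathlib

section
/- Let A be a weighted pushdown system. A has a good cycle (reachable from some configuration) if and only if the summary graph Gr(A) has a positive simple cycle. -/
open scoped BigOperators

namespace PDS

/-- Stack commands over a stack alphabet `Γ`. -/
inductive Com (Γ : Type) where
  | skip : Com Γ
  | pop : Com Γ
  | push (z : Γ) : Com Γ
  deriving DecidableEq

/-- Action of a stack command on a stack string (top of stack at the head). -/
def Com.apply {Γ : Type} : Com Γ → List Γ → List Γ
  | .skip, α => α
  | .pop, α => α.tail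
  | .push z, α => z :: α

/-- A transition (edge) of a pushdown system. -/
structure Edge (Q Γ : Type) where
  q1 : Q
  top : Γ
  q2 : Q
  com : Com Γ
  deriving DecidableEq

/-- A weighted pushdown system. -/
structure WPS (Q Γ : Type) where
  q0 : Q
  bot : Γ
  E : Set (Edge Q Γ)
  w : Edge Q Γ → ℤ
  no_push_bot : ∀ e ∈ E, e.com ≠ Com.push bot
  no_pop_bot : ∀ e ∈ E, e.top = bot → e.com ≠ Com.pop

variable {Q Γ : Type}

/-- A configuration: stack string (top at head) together with a state. -/
abbrev Config (Q Γ : Type) := List Γ × Q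

/-- A genuine configuration has a nonempty stack string. -/
def IsConfig (c : Config Q Γ) : Prop := c.1 ≠ []

/-- The initial configuration `(⊥, q₀)`. -/
def WPS.start (A : WPS Q Γ) : Config Q Γ := ([A.bot], A.q0)

/-- The configuration obtained by taking the edge `e` from `c`. -/
def next (c : Config Q Γ) (e : Edge Q Γ) : Config Q Γ := (e.com.apply c.1, e.q2)

/-- The edge `e` is enabled at configuration `c`. -/
def WPS.Enabled (A : WPS Q Γ) (c : Config Q Γ) (e : Edge Q Γ) : Prop :=
  e ∈ A.E ∧ c.2 = e.q1 ∧ c.1.head? = some e.top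

/-- Validity of a finite path, given by a start configuration and a list of edges. -/
def WPS.Valid (A : WPS Q Γ) : Config Q Γ → List (Edge Q Γ) → Prop
  | _, [] => True
  | c, e :: es => A.Enabled c e ∧ A.Valid (next c e) es

/-- Last configuration of the finite path `(c, es)`. -/
def endc (c : Config Q Γ) (es : List (Edge Q Γ)) : Config Q Γ := es.foldl next c

/-- The list of configurations along the finite path `(c, es)`. -/
def trace (c : Config Q Γ) (es : List (Edge Q Γ)) : List (Config Q Γ) :=
  List.scanl next c es

/-- Total weight of a finite path. -/
def WPS.wt (A : WPS Q Γ) (es : List (Edge Q Γ)) : ℤ := (es.map A.w).sum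

/-- Stack height of a configuration. -/
def height (c : Config Q Γ) : ℕ := c.1.length

/-- Stack height of a finite path: maximal stack height along it. -/
def SH (c : Config Q Γ) (es : List (Edge Q Γ)) : ℕ :=
  ((trace c es).map height).foldr max 0

/-- Additional stack height of a finite path. -/
def ASH (c : Config Q Γ) (es : List (Edge Q Γ)) : ℕ :=
  SH c es - max (height c) (height (endc c es))

/-- The first configuration of the path is a local minima: its stack string is a
prefix (here: suffix of the list, since the top is at the head) of all stack strings
along the path. -/
def FirstMin (c : Config Q Γ) (es : List (Edge Q Γ)) : Prop :=
  ∀ c' ∈ trace c es, c.1 <:+ c'.1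

/-- The edge sequence obtained from `u ++ p₁ ++ v ++ p₂ ++ x` by repeating `p₁` and
`p₂` each `j` times in place. -/
def pumped (u p₁ v p₂ x : List (Edge Q Γ)) (j : ℕ) : List (Edge Q Γ) :=
  u ++ (List.replicate j p₁).flatten ++ v ++ (List.replicate j p₂).flatten ++ x

/-- `(p₁, p₂)` is a pumpable pair of paths for the path `(c, es)`. -/
def WPS.PumpablePair (A : WPS Q Γ) (c : Config Q Γ) (es p₁ p₂ : List (Edge Q Γ)) : Prop :=
  p₁ ≠ [] ∧ p₂ ≠ [] ∧
    ∃ u v x, es = u ++ p₁ ++ v ++ p₂ ++ x ∧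
      ∀ j : ℕ, A.Valid c (pumped u p₁ v p₂ x j)

/-- The path `(c, es)` has a pumpable pair of paths. -/
def WPS.HasPumpablePair (A : WPS Q Γ) (c : Config Q Γ) (es : List (Edge Q Γ)) : Prop :=
  ∃ p₁ p₂, A.PumpablePair c es p₁ p₂

/-- `(c, es)` is a good cycle. -/
def WPS.GoodCycle (A : WPS Q Γ) (c : Config Q Γ) (es : List (Edge Q Γ)) : Prop :=
  A.Valid c es ∧ 0 < A.wt es ∧ FirstMin c es ∧
    (endc c es).2 = c.2 ∧ (endc c es).1.head? = c.1.head?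

/-- `A` has a good cycle reachable from the configuration `c`. -/
def WPS.ReachableGoodCycleFrom (A : WPS Q Γ) (c : Config Q Γ) : Prop :=
  ∃ es₀ es, A.Valid c es₀ ∧ A.GoodCycle (endc c es₀) es

/-- `A` has a good cycle (at some configuration). -/
def WPS.HasGoodCycle (A : WPS Q Γ) : Prop :=
  ∃ c es, IsConfig c ∧ A.GoodCycle c es

/-- The finite path `(c, es)` contains a good cycle. -/
def ContainsGoodCycle (A : WPS Q Γ) (c : Config Q Γ) (es : List (Edge Q Γ)) : Prop :=
  ∃ es₁ es₂, es = es₁ ++ es₂ ∧ A.GoodCycle (endc c es₁) es₂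

/-- Configurations along an infinite path given by an infinite edge sequence. -/
def confs (c : Config Q Γ) (f : ℕ → Edge Q Γ) : ℕ → Config Q Γ
  | 0 => c
  | n + 1 => next (confs c f n) (f n)

/-- Validity of the infinite path `(c, f)`. -/
def WPS.ValidInf (A : WPS Q Γ) (c : Config Q Γ) (f : ℕ → Edge Q Γ) : Prop :=
  ∀ n, A.Enabled (confs c f n) (f n)

/-- Average weight of the prefix of length `n+1` of an infinite path. -/
noncomputable def avgPref (A : WPS Q Γ) (f : ℕ → Edge Q Γ) (n : ℕ) : ℝ :=
  (∑ i ∈ Finset.range (n + 1), (A.w (f i) : ℝ)) / (n + 1)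

/-- Limit-sup of the averages along an infinite path. -/
noncomputable def LimSupAvg (A : WPS Q Γ) (f : ℕ → Edge Q Γ) : ℝ :=
  Filter.limsup (avgPref A f) Filter.atTop

/-- Limit-inf of the averages along an infinite path. -/
noncomputable def LimInfAvg (A : WPS Q Γ) (f : ℕ → Edge Q Γ) : ℝ :=
  Filter.liminf (avgPref A f) Filter.atTop

/-- An infinite edge sequence is ultimately periodic. -/
def UltPeriodic (f : ℕ → Edge Q Γ) : Prop :=
  ∃ N p : ℕ, 0 < p ∧ ∀ n, N ≤ n → f (n + p) = f n

/-- The infinite path `(c, f)` is stack bounded. -/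
def StackBounded (c : Config Q Γ) (f : ℕ → Edge Q Γ) : Prop :=
  ∃ n : ℕ, ∀ k, height (confs c f k) ≤ n

/-- Non-decreasing path: a valid path whose first configuration is a local minima. -/
def WPS.NonDec (A : WPS Q Γ) (c : Config Q Γ) (es : List (Edge Q Γ)) : Prop :=
  A.Valid c es ∧ FirstMin c es

/-- Summary function, valued in `EReal`: `⊥` means there is no non-decreasing path
from `(⊥γ,q₁)` to `(⊥γ,q₂)`, `⊤` means `ω` (weights unbounded from above), and
otherwise the value is the maximal weight of such a path. -/
noncomputable def WPS.summary (A : WPS Q Γ) (q₁ : Q) (γ : Γ) (q₂ : Q) : EReal :=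
  sSup { x : EReal | ∃ es, A.NonDec ([γ, A.bot], q₁) es ∧
    endc ([γ, A.bot], q₁) es = ([γ, A.bot], q₂) ∧ x = ((A.wt es : ℝ) : EReal) }

/-- Stack height bounded summary function: as `summary` but only over non-decreasing
paths of additional stack height at most `d`. -/
noncomputable def WPS.summaryBdd (A : WPS Q Γ) (d : ℕ) (q₁ : Q) (γ : Γ) (q₂ : Q) : EReal :=
  sSup { x : EReal | ∃ es, A.NonDec ([γ, A.bot], q₁) es ∧
    endc ([γ, A.bot], q₁) es = ([γ, A.bot], q₂) ∧ ASH ([γ, A.bot], q₁) es ≤ d ∧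
    x = ((A.wt es : ℝ) : EReal) }

/-- Edges of the summary graph `Gr(A)` together with their weights in `EReal`
(`⊤` plays the role of `ω`): skip edges weighted by the summary function and push
edges weighted by the corresponding transition weight. -/
def WPS.GrEdge (A : WPS Q Γ) (v₁ v₂ : Q × Γ) (x : EReal) : Prop :=
  (v₁.2 = v₂.2 ∧ A.summary v₁.1 v₁.2 v₂.1 ≠ ⊥ ∧ x = A.summary v₁.1 v₁.2 v₂.1) ∨
  (∃ e ∈ A.E, e.q1 = v₁.1 ∧ e.top = v₁.2 ∧ e.q2 = v₂.1 ∧ e.com = Com.push v₂.2 ∧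
    x = ((A.w e : ℝ) : EReal))

/-- The summary graph `Gr(A)` has a positive simple cycle: a simple cycle containing
an `ω`-edge or whose total weight is positive. -/
def WPS.PosSimpleCycle (A : WPS Q Γ) : Prop :=
  ∃ (k : ℕ) (v : Fin (k + 1) → Q × Γ) (x : Fin (k + 1) → EReal),
    Function.Injective v ∧ (∀ i, A.GrEdge (v i) (v (i + 1)) (x i)) ∧
    ((∃ i, x i = ⊤) ∨ (0 : EReal) < ∑ i, x i)

/-- Weight of a finite path under the shifted weight function `w + r`. -/
def WPS.wtQ (A : WPS Q Γ) (r : ℚ) (es : List (Edge Q Γ)) : ℚ :=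
  (es.map (fun e => (A.w e : ℚ) + r)).sum

/-- The shifted system `A^r` (weight function `w + r`) has a good cycle. -/
def WPS.GoodCycleShift (A : WPS Q Γ) (r : ℚ) : Prop :=
  ∃ c es, IsConfig c ∧ A.Valid c es ∧ 0 < A.wtQ r es ∧ FirstMin c es ∧
    (endc c es).2 = c.2 ∧ (endc c es).1.head? = c.1.head?

end PDS

namespace PDS

section PositiveCycle

variable {V : Type*} {R : V → V → EReal → Prop}

/-- A positive closed walk in an `EReal`-weighted graph contains a positive simple cycle. -/
theorem exists_injective_cycle_of_closed_walk (n : ℕ) (v : ℕ → V) (x : ℕ → EReal)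
    (hclosed : v n = v 0) (hwalk : ∀ i < n, R (v i) (v (i + 1)) (x i))
    (hpos : 0 < ∑ i ∈ Finset.range n, x i) :
    ∃ (k : ℕ) (v : Fin (k + 1) → V) (x : Fin (k + 1) → EReal),
      Function.Injective v ∧ (∀ i, R (v i) (v (i + 1)) (x i)) ∧ 0 < ∑ i, x i := by
  induction n using Nat.strong_induction_on generalizing v x with
  | _ n ih =>
  by_cases hinj : ∀ i j, i < j → j < n → v i ≠ v j
  · obtain _ | k := n
    · simp at hpos
    · refine ⟨k, fun i => v i, fun i => x i, ?_, ?_, ?_⟩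
      · intro i j hij
        rcases lt_trichotomy i j with h | h | h
        · exact absurd hij (hinj i j h j.2)
        · exact h
        · exact absurd hij.symm (hinj j i h i.2)
      · intro i
        have hi := hwalk i i.2
        beta_reduce
        rw [Fin.val_add_one]
        split_ifs with h
        · subst h
          simp only [Fin.val_last] at hi ⊢
          rwa [hclosed] at hi
        · exact hi
      · rwa [Finset.sum_range] at hpos
  · push Not at hinj
    obtain ⟨i, j, hij, hjn, hv⟩ := hinj
    obtain ⟨d, rfl⟩ := Nat.exists_eq_add_of_lt hij
    obtain ⟨m, rfl⟩ := Nat.exists_eq_add_of_lt hjn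
    have hsplit : ∑ l ∈ Finset.range (i + d + 1 + m + 1), x l =
        ∑ l ∈ Finset.range (d + 1), x (i + l) +
          ∑ l ∈ Finset.range (i + (m + 1)), (if l < i then x l else x (l + (d + 1))) := by
      rw [show i + d + 1 + m + 1 = i + (d + 1) + (m + 1) by ring, Finset.sum_range_add,
        Finset.sum_range_add, Finset.sum_range_add _ i (m + 1)]
      rw [add_comm (∑ l ∈ Finset.range i, x l), add_assoc]
      congr 2
      · exact Finset.sum_congr rfl fun l hl => by simp [Finset.mem_range.1 hl]
      · refine Finset.sum_congr rfl fun l _ => ?_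
        rw [if_neg (by omega)]
        congr 1
        omega
    rw [hsplit] at hpos
    by_cases h1 : 0 < ∑ l ∈ Finset.range (d + 1), x (i + l)
    · exact ih (d + 1) (by omega) (fun l => v (i + l)) (fun l => x (i + l))
        (by simpa [add_assoc] using hv.symm) (fun l hl => hwalk (i + l) (by omega)) h1
    · have h2 : 0 < ∑ l ∈ Finset.range (i + (m + 1)),
          (if l < i then x l else x (l + (d + 1))) := by
        by_contra h2
        exact absurd hpos (not_lt.2 (add_nonpos (not_lt.1 h1) (not_lt.1 h2)))
      refine ih (i + (m + 1)) (by omega) (fun l => if l ≤ i then v l else v (l + (d + 1)))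
        (fun l => if l < i then x l else x (l + (d + 1))) ?_ ?_ h2
      · simp only [Nat.zero_le, if_true]
        rw [if_neg (by omega), ← hclosed]
        congr 1
        omega
      · intro l hl
        rcases lt_trichotomy l i with h | rfl | h
        · simpa [h, h.le, Nat.succ_le_of_lt h] using hwalk l (by omega)
        · have := hwalk (l + d + 1) (by omega)
          rw [← hv] at this
          simpa [add_assoc, add_comm, add_left_comm] using this
        · have := hwalk (l + (d + 1)) (by omega)
          simp only [show ¬ l ≤ i by omega, show ¬ l + 1 ≤ i by omega, show ¬ l < i by omega,
            if_false]
          rwa [show l + 1 + (d + 1) = l + (d + 1) + 1 by omega]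

end PositiveCycle

section Paths

@[simp] theorem endc_nil (c : Config Q Γ) : endc c [] = c := rfl

@[simp] theorem endc_cons (c : Config Q Γ) (e : Edge Q Γ) (es : List (Edge Q Γ)) :
    endc c (e :: es) = endc (next c e) es := rfl

@[simp] theorem endc_append (c : Config Q Γ) (es fs : List (Edge Q Γ)) :
    endc c (es ++ fs) = endc (endc c es) fs := List.foldl_append

/-- Every configuration of the path `(c, es)` has a stack extending `α`. -/
def Above (α : List Γ) : Config Q Γ → List (Edge Q Γ) → Prop
  | c, [] => α <:+ c.1
  | c, e :: es => α <:+ c.1 ∧ Above α (next c e) es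

theorem above_iff_forall_trace (α : List Γ) (c : Config Q Γ) (es : List (Edge Q Γ)) :
    Above α c es ↔ ∀ c' ∈ trace c es, α <:+ c'.1 := by
  induction es generalizing c with
  | nil => simp [Above, trace]
  | cons e es ih =>
    rw [Above, ih]
    simp [trace]

theorem firstMin_iff_above (c : Config Q Γ) (es : List (Edge Q Γ)) :
    FirstMin c es ↔ Above c.1 c es :=
  (above_iff_forall_trace c.1 c es).symm

theorem Above.mono {α β : List Γ} (hαβ : α <:+ β) {c : Config Q Γ} {es : List (Edge Q Γ)}
    (h : Above β c es) : Above α c es := by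
  rw [above_iff_forall_trace] at h ⊢
  exact fun c' hc' => hαβ.trans (h c' hc')

theorem Above.start {α : List Γ} {c : Config Q Γ} {es : List (Edge Q Γ)}
    (h : Above α c es) : α <:+ c.1 := by
  cases es with
  | nil => exact h
  | cons e es => exact h.1

theorem above_append {α : List Γ} {c : Config Q Γ} {es fs : List (Edge Q Γ)} :
    Above α c (es ++ fs) ↔ Above α c es ∧ Above α (endc c es) fs := by
  induction es generalizing c with
  | nil => exact ⟨fun h => ⟨h.start, h⟩, fun h => h.2⟩
  | cons e es ih => simp [Above, ih, and_assoc]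

theorem valid_append {A : WPS Q Γ} {c : Config Q Γ} {es fs : List (Edge Q Γ)} :
    A.Valid c (es ++ fs) ↔ A.Valid c es ∧ A.Valid (endc c es) fs := by
  induction es generalizing c with
  | nil => simp [WPS.Valid]
  | cons e es ih => simp [WPS.Valid, ih, and_assoc]

theorem wt_append (A : WPS Q Γ) (es fs : List (Edge Q Γ)) :
    A.wt (es ++ fs) = A.wt es + A.wt fs := by
  simp [WPS.wt]

/-- A path that never goes below the symbol `γ` can be replayed over any other stack
content below `γ`. -/
theorem replay_above {A : WPS Q Γ} {γ : Γ} {β : List Γ} (es : List (Edge Q Γ))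
    (s : List Γ) (q : Q) (hvalid : A.Valid (s ++ γ :: β, q) es)
    (habove : Above (γ :: β) (s ++ γ :: β, q) es) :
    ∃ s' q', endc (s ++ γ :: β, q) es = (s' ++ γ :: β, q') ∧
      ∀ β', A.Valid (s ++ γ :: β', q) es ∧ Above (γ :: β') (s ++ γ :: β', q) es ∧
        endc (s ++ γ :: β', q) es = (s' ++ γ :: β', q') := by
  induction es generalizing s q with
  | nil => exact ⟨s, q, rfl, fun β' => ⟨trivial, List.suffix_append _ _, rfl⟩⟩
  | cons e es ih =>
    obtain ⟨hen, hvalid⟩ := hvalid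
    have hstep : ∃ s₁, ∀ β', next (s ++ γ :: β', q) e = (s₁ ++ γ :: β', e.q2) ∨
        (s = [] ∧ e.com = Com.pop) := by
      rcases hcom : e.com with _ | _ | z
      · exact ⟨s, fun β' => by simp [next, hcom, Com.apply]⟩
      · cases s with
        | nil => exact ⟨[], fun _ => Or.inr ⟨rfl, rfl⟩⟩
        | cons a s => exact ⟨s, fun β' => by simp [next, hcom, Com.apply]⟩
      · exact ⟨z :: s, fun β' => by simp [next, hcom, Com.apply]⟩
    have hnot : ¬ (s = [] ∧ e.com = Com.pop) := by
      rintro ⟨rfl, hcom⟩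
      have := habove.2.start.length_le
      simp [next, hcom, Com.apply] at this
    obtain ⟨s₁, hs₁⟩ := hstep
    replace hs₁ := fun β' => (hs₁ β').resolve_right hnot
    obtain ⟨s', q', hend, hall⟩ := ih s₁ e.q2 (hs₁ β ▸ hvalid) (hs₁ β ▸ habove.2)
    refine ⟨s', q', by rw [endc_cons, hs₁, hend], fun β' => ⟨⟨⟨hen.1, hen.2.1, ?_⟩, ?_⟩,
      ⟨List.suffix_append _ _, ?_⟩, ?_⟩⟩
    · rw [← hen.2.2]
      cases s <;> rfl
    · rw [hs₁]
      exact (hall β').1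
    · rw [hs₁]
      exact (hall β').2.1
    · rw [endc_cons, hs₁]
      exact (hall β').2.2

/-- A loop on the stack `γ :: β` can be replayed on the stack `γ :: β'`. -/
theorem replay_above_of_endc_eq {A : WPS Q Γ} {γ : Γ} {β : List Γ} {es : List (Edge Q Γ)}
    {q q' : Q} (hvalid : A.Valid (γ :: β, q) es) (habove : Above (γ :: β) (γ :: β, q) es)
    (hend : endc (γ :: β, q) es = (γ :: β, q')) (β' : List Γ) :
    A.Valid (γ :: β', q) es ∧ Above (γ :: β') (γ :: β', q) es ∧
      endc (γ :: β', q) es = (γ :: β', q') := by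
  obtain ⟨s', q'', hend', hall⟩ := replay_above es [] q hvalid habove
  simp only [List.nil_append] at hend' hall
  rw [hend, Prod.mk.injEq, List.self_eq_append_left] at hend'
  obtain ⟨rfl, rfl⟩ := hend'
  exact hall β'

/-- A path that stays above `α` and never has stack exactly `α` stays above its
first symbol over `α`. -/
theorem Above.cons_of_forall_ne {α : List Γ} {z : Γ} {c : Config Q Γ} {es : List (Edge Q Γ)}
    (hstart : z :: α <:+ c.1) (habove : Above α c es)
    (hne : ∀ fs gs, es = fs ++ gs → (endc c fs).1 ≠ α) : Above (z :: α) c es := by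
  induction es generalizing c with
  | nil => exact hstart
  | cons e es ih =>
    refine ⟨hstart, ih ?_ habove.2 fun fs gs h => hne (e :: fs) gs (by simp [h])⟩
    have hne' : (next c e).1 ≠ α := hne [e] es rfl
    obtain ⟨t, ht⟩ := hstart
    rcases hcom : e.com with _ | _ | y
    · simp [next, hcom, Com.apply, ← ht]
    · cases t with
      | nil => simp [next, hcom, Com.apply, ← ht] at hne'
      | cons a t => simp [next, hcom, Com.apply, ← ht]
    · simp only [next, hcom, Com.apply, ← ht]
      exact List.suffix_append (y :: t) _

end Paths

section SummaryGraph

theorem le_summary {A : WPS Q Γ} {γ : Γ} {β : List Γ} {es : List (Edge Q Γ)} {q q' : Q}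
    (hvalid : A.Valid (γ :: β, q) es) (habove : Above (γ :: β) (γ :: β, q) es)
    (hend : endc (γ :: β, q) es = (γ :: β, q')) :
    ((A.wt es : ℝ) : EReal) ≤ A.summary q γ q' := by
  obtain ⟨h1, h2, h3⟩ := replay_above_of_endc_eq hvalid habove hend [A.bot]
  exact le_sSup ⟨es, ⟨h1, (firstMin_iff_above _ _).2 h2⟩, h3, rfl⟩

/-- Every edge of the summary graph is realised, up to arbitrarily small loss of weight,
by a path over any stack content. -/
theorem WPS.GrEdge.exists_path {A : WPS Q Γ} {u v : Q × Γ} {x a : EReal} (h : A.GrEdge u v x)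
    (ha : a < x) (β : List Γ) :
    ∃ es β', A.Valid (u.2 :: β, u.1) es ∧ Above (u.2 :: β) (u.2 :: β, u.1) es ∧
      endc (u.2 :: β, u.1) es = (v.2 :: β', v.1) ∧ a ≤ ((A.wt es : ℝ) : EReal) := by
  rcases h with ⟨hγ, -, rfl⟩ | ⟨e, he, h1, h2, h3, hcom, rfl⟩
  · obtain ⟨_, ⟨es, hnd, hend, rfl⟩, hlt⟩ := lt_sSup_iff.1 ha
    obtain ⟨k1, k2, k3⟩ := replay_above_of_endc_eq hnd.1 ((firstMin_iff_above _ _).1 hnd.2) hend β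
    exact ⟨es, β, k1, k2, hγ ▸ k3, hlt.le⟩
  · refine ⟨[e], u.2 :: β, ⟨⟨he, h1.symm, by simp [h2]⟩, trivial⟩, ⟨List.suffix_rfl, ?_⟩, ?_, ?_⟩
    · simp [Above, next, hcom, Com.apply]
    · simp [next, hcom, Com.apply, h3]
    · simpa [WPS.wt] using ha.le

/-- Every walk of the summary graph is realised, up to arbitrarily small loss of weight,
by a path over any stack content. -/
theorem exists_path_of_walk {A : WPS Q Γ} (n : ℕ) (v : ℕ → Q × Γ) (x : ℕ → EReal)
    (hwalk : ∀ i < n, A.GrEdge (v i) (v (i + 1)) (x i)) (a : EReal)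
    (ha : a < ∑ i ∈ Finset.range n, x i) (β : List Γ) :
    ∃ es β', A.Valid ((v 0).2 :: β, (v 0).1) es ∧
      Above ((v 0).2 :: β) ((v 0).2 :: β, (v 0).1) es ∧
      endc ((v 0).2 :: β, (v 0).1) es = ((v n).2 :: β', (v n).1) ∧
      a ≤ ((A.wt es : ℝ) : EReal) := by
  induction n generalizing a with
  | zero =>
    refine ⟨[], β, trivial, List.suffix_rfl, rfl, ?_⟩
    simpa [WPS.wt] using ha.le
  | succ n ih =>
    rw [Finset.sum_range_succ] at ha
    obtain ⟨b, hb, d, hd, hlt⟩ : ∃ b < ∑ i ∈ Finset.range n, x i, ∃ d < x n, a < b + d := by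
      by_contra! hcon
      exact absurd ha (not_lt.2 (EReal.add_le_of_forall_lt hcon))
    obtain ⟨es, β₁, h1, h2, h3, h4⟩ := ih (fun i hi => hwalk i (by omega)) b hb
    obtain ⟨fs, β₂, k1, k2, k3, k4⟩ := (hwalk n (by omega)).exists_path hd β₁
    refine ⟨es ++ fs, β₂, valid_append.2 ⟨h1, h3 ▸ k1⟩, above_append.2 ⟨h2, ?_⟩, ?_, ?_⟩
    · rw [h3]
      refine k2.mono ?_
      have := (above_append (fs := []).1 (by simpa using h2)).2
      rw [h3] at this
      exact this
    · rw [endc_append, h3, k3]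
    · refine hlt.le.trans ((add_le_add h4 k4).trans ?_)
      rw [wt_append]
      push_cast
      rfl

/-- The summary graph has a walk from `u` to `v` of weight at least `a`. -/
def HasWalk (A : WPS Q Γ) (u v : Q × Γ) (a : EReal) : Prop :=
  ∃ (n : ℕ) (p : ℕ → Q × Γ) (x : ℕ → EReal), p 0 = u ∧ p n = v ∧
    (∀ i < n, A.GrEdge (p i) (p (i + 1)) (x i)) ∧ a ≤ ∑ i ∈ Finset.range n, x i

theorem HasWalk.cons {A : WPS Q Γ} {u v w : Q × Γ} {x a b : EReal} (h : A.GrEdge u v x)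
    (hb : b ≤ x) (hw : HasWalk A v w a) : HasWalk A u w (b + a) := by
  obtain ⟨n, p, y, rfl, hn, hE, ha⟩ := hw
  refine ⟨n + 1, fun i => Nat.casesOn i u p, fun i => Nat.casesOn i x y, rfl, hn, ?_, ?_⟩
  · rintro (_ | i) hi
    · exact h
    · exact hE i (by omega)
  · rw [Finset.sum_range_succ', add_comm b]
    exact add_le_add ha hb

/-- A non-decreasing path induces a walk of the summary graph of at least the same weight. -/
theorem hasWalk_of_path {A : WPS Q Γ} {γ γ' : Γ} {β β' : List Γ} {q q' : Q}
    {es : List (Edge Q Γ)} (hvalid : A.Valid (γ :: β, q) es)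
    (habove : Above (γ :: β) (γ :: β, q) es) (hend : endc (γ :: β, q) es = (γ' :: β', q')) :
    HasWalk A (q, γ) (q', γ') ((A.wt es : ℝ) : EReal) := by
  induction hlen : es.length using Nat.strong_induction_on generalizing es γ β q with
  | _ n ih =>
  subst hlen
  have hwt (fs gs : List (Edge Q Γ)) : ((A.wt (fs ++ gs) : ℝ) : EReal) =
      ((A.wt fs : ℝ) : EReal) + ((A.wt gs : ℝ) : EReal) := by
    rw [wt_append]
    push_cast
    rfl
  by_cases hret : ∃ fs gs, es = fs ++ gs ∧ fs ≠ [] ∧ (endc (γ :: β, q) fs).1 = γ :: β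
  · obtain ⟨fs, gs, rfl, hfs, hstack⟩ := hret
    obtain ⟨q₁, hq₁⟩ : ∃ q₁, endc (γ :: β, q) fs = (γ :: β, q₁) := ⟨_, Prod.ext hstack rfl⟩
    rw [valid_append, hq₁] at hvalid
    rw [above_append, hq₁] at habove
    rw [endc_append, hq₁] at hend
    have hle := le_summary hvalid.1 habove.1 hq₁
    have hedge : A.GrEdge (q, γ) (q₁, γ) (A.summary q γ q₁) :=
      Or.inl ⟨rfl, ne_bot_of_le_ne_bot (EReal.coe_ne_bot _) hle, rfl⟩
    have hpos := List.length_pos_iff.2 hfs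
    rw [hwt]
    exact HasWalk.cons hedge hle (ih gs.length (by simp; omega) hvalid.2 habove.2 hend rfl)
  · push Not at hret
    cases es with
    | nil =>
      simp only [endc_nil, Prod.mk.injEq, List.cons.injEq] at hend
      obtain ⟨⟨rfl, -⟩, rfl⟩ := hend
      exact ⟨0, fun _ => (q, γ), 0, rfl, rfl, by simp, by simp [WPS.wt]⟩
    | cons e es =>
      have hfirst := hret [e] es rfl (by simp)
      obtain ⟨hen, hvalid⟩ := hvalid
      have hab := habove.2
      rcases hcom : e.com with _ | _ | z
      · simp [next, hcom, Com.apply] at hfirst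
      · have := hab.start.length_le
        simp [next, hcom, Com.apply] at this
      · have hnext : next (γ :: β, q) e = (z :: γ :: β, e.q2) := by
          simp [next, hcom, Com.apply]
        rw [hnext] at hvalid hab
        rw [endc_cons, hnext] at hend
        have hab' : Above (z :: γ :: β) (z :: γ :: β, e.q2) es :=
          hab.cons_of_forall_ne List.suffix_rfl fun fs gs h => by
            have := hret (e :: fs) gs (by simp [h]) (by simp)
            rwa [endc_cons, hnext] at this
        have hedge : A.GrEdge (q, γ) (e.q2, z) ((A.w e : ℝ) : EReal) :=
          Or.inr ⟨e, hen.1, hen.2.1.symm, by simpa using hen.2.2.symm, rfl, hcom, rfl⟩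
        rw [← List.singleton_append, hwt]
        exact HasWalk.cons hedge (by simp [WPS.wt]) (ih es.length (by simp) hvalid hab' hend rfl)

theorem WPS.GrEdge.ne_bot {A : WPS Q Γ} {u v : Q × Γ} {x : EReal} (h : A.GrEdge u v x) : x ≠ ⊥ := by
  rcases h with ⟨-, h, rfl⟩ | ⟨e, -, -, -, -, -, rfl⟩
  · exact h
  · exact EReal.coe_ne_bot _

end SummaryGraph

end PDS

open PDS in
/-- a WPS has a good cycle iff its summary graph has a positive simple
cycle. -/
theorem good_cycle_iff_positive_simple_cycle
    {Q Γ : Type} [Fintype Q] [Fintype Γ] (A : WPS Q Γ) :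
    A.HasGoodCycle ↔ A.PosSimpleCycle := by
  constructor
  · rintro ⟨⟨α, q⟩, es, hconf, hvalid, hwt, hmin, hq, hhead⟩
    obtain ⟨γ, β, rfl⟩ := List.exists_cons_of_ne_nil hconf
    obtain ⟨β', hβ'⟩ := List.head?_eq_some_iff.1 hhead
    obtain ⟨n, p, x, h0, hn, hE, hle⟩ := hasWalk_of_path hvalid ((firstMin_iff_above _ _).1 hmin)
      (Prod.ext hβ' hq : endc (γ :: β, q) es = (γ :: β', q))
    obtain ⟨k, v, y, hinj, hedge, hpos⟩ :=
      exists_injective_cycle_of_closed_walk n p x (hn.trans h0.symm) hE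
        (lt_of_lt_of_le (by exact_mod_cast hwt) hle)
    exact ⟨k, v, y, hinj, hedge, Or.inr hpos⟩
  · rintro ⟨k, v, x, -, hE, hpos⟩
    have hpos' : 0 < ∑ i, x i := by
      refine hpos.elim (fun ⟨i, hi⟩ => ?_) id
      have hne : ∑ j ∈ Finset.univ.erase i, x j ≠ ⊥ :=
        Finset.sum_induction x (· ≠ ⊥) (fun a b ha hb => by simp [EReal.add_eq_bot_iff, ha, hb])
          EReal.zero_ne_bot fun j _ => (hE j).ne_bot
      rw [← Finset.add_sum_erase _ _ (Finset.mem_univ i), hi, EReal.top_add_of_ne_bot hne]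
      exact EReal.zero_lt_top
    obtain ⟨a, ha, hlt⟩ := exists_between hpos'
    obtain ⟨es, β', h1, h2, h3, h4⟩ := exists_path_of_walk (A := A) (k + 1)
      (fun i => v (Fin.ofNat (k + 1) i)) (fun i => x (Fin.ofNat (k + 1) i))
      (fun i _ => by
        convert hE (Fin.ofNat (k + 1) i) using 2
        simp [Fin.ext_iff, Fin.val_add]) a
      (by simpa [Finset.sum_range] using hlt) []
    refine ⟨_, es, by simp [IsConfig], h1, by exact_mod_cast ha.trans_le h4,
      (firstMin_iff_above _ _).2 h2, ?_, ?_⟩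
    · rw [h3]
      simp [Fin.ofNat]
    · rw [h3]
      simp [Fin.ofNat]
end

section
/- Let A be a weighted pushdown system. There exists an infinite valid path π from the initial configuration with LimInfAvg(π) ≥ 0 if and only if for every ε > 0 there exists an infinite valid path π_ε from the initial configuration with LimInfAvg(π_ε) > −ε. -/
open scoped BigOperators

namespace PDS

section Sequences

/-- Concatenation of finite blocks `g 0, g 1, …` of positive lengths `l 0, l 1, …`. -/
lemma exists_concat {α : Type*} (l : ℕ → ℕ) (hl : ∀ n, 0 < l n) (g : ℕ → ℕ → α) :
    ∃ F : ℕ → α, ∀ n s, s < l n → F ((∑ i ∈ Finset.range n, l i) + s) = g n s := by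
  classical
  set T : ℕ → ℕ := fun n => ∑ i ∈ Finset.range n, l i with hT
  have hsucc : ∀ n, T (n + 1) = T n + l n := fun n => Finset.sum_range_succ _ _
  have hmono : StrictMono T := strictMono_nat_of_lt_succ fun n => by
    have := hl n
    rw [hsucc]; omega
  refine ⟨fun k => g (Nat.findGreatest (fun n => T n ≤ k) k)
    (k - T (Nat.findGreatest (fun n => T n ≤ k) k)), fun n s hs => ?_⟩
  have hfind : Nat.findGreatest (fun j => T j ≤ T n + s) (T n + s) = n := by
    rw [Nat.findGreatest_eq_iff]
    refine ⟨(hmono.le_apply).trans (Nat.le_add_right _ _), fun _ => Nat.le_add_right _ _,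
      fun j hj _ hle => ?_⟩
    have := hmono.monotone (Nat.succ_le_of_lt hj)
    rw [Nat.succ_eq_add_one, hsucc] at this
    omega
  change g (Nat.findGreatest (fun j => T j ≤ T n + s) (T n + s))
    (T n + s - T (Nat.findGreatest (fun j => T j ≤ T n + s) (T n + s))) = g n s
  rw [hfind, Nat.add_sub_cancel_left]

/-- Every index lies in one of the consecutive blocks of positive lengths `l 0, l 1, …`. -/
lemma exists_block (l : ℕ → ℕ) (hl : ∀ n, 0 < l n) (k : ℕ) :
    ∃ n s, s < l n ∧ k = (∑ i ∈ Finset.range n, l i) + s := by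
  induction k with
  | zero => exact ⟨0, 0, hl 0, by simp⟩
  | succ k ih =>
    obtain ⟨n, s, hs, rfl⟩ := ih
    by_cases h : s + 1 < l n
    · exact ⟨n, s + 1, h, by omega⟩
    · exact ⟨n + 1, 0, hl _, by rw [Finset.sum_range_succ]; omega⟩

lemma le_sum_of_pos (l : ℕ → ℕ) (hl : ∀ n, 0 < l n) (n : ℕ) :
    n ≤ ∑ i ∈ Finset.range n, l i := by
  simpa using Finset.card_nsmul_le_sum (Finset.range n) l 1 fun i _ => hl i

lemma neg_mul_le_sum {a : ℕ → ℝ} {M : ℝ} (ha : ∀ k, |a k| ≤ M) (n : ℕ) :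
    -(M * n) ≤ ∑ k ∈ Finset.range n, a k := by
  have := Finset.card_nsmul_le_sum (Finset.range n) a (-M) fun k _ => (abs_le.1 (ha k)).1
  simp only [Finset.card_range, nsmul_eq_mul] at this
  linarith

/-- If the blocks have asymptotically nonnegative averages and sublinear lengths, then the
partial sums are bounded below by `-K - ε t` for every `ε > 0`. -/
lemma exists_sum_lower_bound {a : ℕ → ℝ} {M G : ℝ} (ha : ∀ k, |a k| ≤ M) (hG : 0 ≤ G)
    {l : ℕ → ℕ} (hl : ∀ n, 0 < l n)
    (h : ∀ η : ℝ, 0 < η → ∃ N, ∀ n ≥ N,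
      -(η * l n) ≤ ∑ s ∈ Finset.range (l n), a ((∑ i ∈ Finset.range n, l i) + s) ∧
        (l n : ℝ) ≤ η * (n + G))
    {ε : ℝ} (hε : 0 < ε) :
    ∃ K : ℝ, ∀ t : ℕ, -K - ε * t ≤ ∑ k ∈ Finset.range t, a k := by
  have hM : 0 ≤ M := (abs_nonneg _).trans (ha 0)
  set T : ℕ → ℕ := fun n => ∑ i ∈ Finset.range n, l i with hT
  have hsucc : ∀ n, T (n + 1) = T n + l n := fun n => Finset.sum_range_succ _ _
  set η : ℝ := ε / (M + 1) with hη
  have hηpos : 0 < η := by positivity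
  have hηε : η + M * η = ε := by rw [hη]; field_simp; ring
  obtain ⟨N, hN⟩ := h η hηpos
  have hblocks : ∀ n ≥ N, -(M * T N) - η * T n ≤ ∑ k ∈ Finset.range (T n), a k := by
    intro n hn
    induction n, hn using Nat.le_induction with
    | base =>
      have := neg_mul_le_sum ha (T N)
      have h2 : 0 ≤ η * (T N : ℝ) := by positivity
      linarith
    | succ n hn ih =>
      have h1 := (hN n hn).1
      rw [hsucc, Finset.sum_range_add]
      push_cast
      linarith
  refine ⟨M * T N + M * (η * G), fun t => ?_⟩
  have hMG : 0 ≤ M * (η * G) := by positivity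
  obtain ⟨n, s, hs, rfl⟩ := exists_block l hl t
  change _ - ε * ((T n + s : ℕ) : ℝ) ≤ ∑ k ∈ Finset.range (T n + s), a k
  rcases lt_or_ge n N with hn | hn
  · have hle : T n + s ≤ T N := by
      have h1 : T (n + 1) ≤ T N :=
        Finset.sum_le_sum_of_subset (Finset.range_subset_range.2 hn)
      rw [hsucc] at h1
      omega
    have h1 := neg_mul_le_sum ha (T n + s)
    have h2 : M * ((T n + s : ℕ) : ℝ) ≤ M * (T N : ℝ) :=
      mul_le_mul_of_nonneg_left (by exact_mod_cast hle) hM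
    have h3 : 0 ≤ ε * ((T n + s : ℕ) : ℝ) := by positivity
    linarith
  · have h1 := hblocks n hn
    have h2 := neg_mul_le_sum (fun k => ha (T n + k)) s
    have h3 : M * (s : ℝ) ≤ M * (η * (n + G)) := by
      refine mul_le_mul_of_nonneg_left (le_trans ?_ (hN n hn).2) hM
      exact_mod_cast hs.le
    have h4 : (n : ℝ) ≤ T n := by exact_mod_cast le_sum_of_pos l hl n
    have h5 : M * (η * n) ≤ M * (η * T n) := by gcongr
    have h6 : 0 ≤ ε * (s : ℝ) := by positivity
    have h7 : ε * (T n : ℝ) = η * T n + M * (η * T n) := by rw [← hηε]; ring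
    rw [Finset.sum_range_add]
    push_cast
    linarith

/-- Every `g : ℕ → ℕ` can be slowed down to grow at most linearly along a sequence tending to
infinity. -/
lemma exists_slow_reindex (g : ℕ → ℕ) :
    ∃ m : ℕ → ℕ, (∀ n, g (m n) ≤ n + g 0) ∧ ∀ K, ∃ N, ∀ n ≥ N, K ≤ m n := by
  refine ⟨fun n => Nat.findGreatest (fun k => g k ≤ n + g 0) n, fun n => ?_, fun K =>
    ⟨max K (g K), fun n hn => ?_⟩⟩
  · exact Nat.findGreatest_spec (P := fun k => g k ≤ n + g 0) (Nat.zero_le n)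
      (Nat.le_add_left _ _)
  · have h1 := le_max_left K (g K)
    have h2 := le_max_right K (g K)
    exact Nat.le_findGreatest (by omega) (by omega)

/-- A sequence of naturals has arbitrarily late positions that minimise its tail. -/
lemma exists_tail_min (h : ℕ → ℕ) (N : ℕ) : ∃ i ≥ N, ∀ j ≥ i, h i ≤ h j := by
  obtain ⟨i, hi, hmin⟩ := WellFounded.has_min (measure h).wf (Set.Ici N) ⟨N, Set.self_mem_Ici⟩
  exact ⟨i, hi, fun j hj => not_lt.1 (hmin j (le_trans hi hj))⟩

/-- Pigeonhole: a property holding frequently holds frequently on a fibre of a map to a finite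
type. -/
lemma frequently_fiber {α : Type*} [Finite α] {p : ℕ → Prop} {r : ℕ → α → Prop}
    (hp : ∃ᶠ n in Filter.atTop, p n) (hr : ∀ n, p n → ∃ v, r n v) :
    ∃ v, ∃ᶠ n in Filter.atTop, r n v := by
  by_contra! hcon
  have : ∀ᶠ n in Filter.atTop, ∀ v, ¬ r n v :=
    Filter.eventually_all.2 fun v => hcon v
  obtain ⟨n, hn, hn'⟩ := (hp.and_eventually this).exists
  obtain ⟨v, hv⟩ := hr n hn
  exact hn' v hv

end Sequences

section Paths

variable {Q Γ : Type}

instance [Finite Γ] : Finite (Com Γ) :=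
  Finite.of_injective (β := Option (Option Γ))
    (fun c => match c with
      | .skip => none
      | .pop => some none
      | .push z => some (some z))
    (by rintro (_ | _ | _) (_ | _ | _) <;> simp)

instance [Finite Q] [Finite Γ] : Finite (Edge Q Γ) :=
  Finite.of_injective (fun e : Edge Q Γ => (e.q1, e.top, e.q2, e.com))
    (by rintro ⟨⟩ ⟨⟩ h; simp_all)

lemma WPS.exists_weight_bound [Finite Q] [Finite Γ] (A : WPS Q Γ) :
    ∃ M : ℝ, ∀ e, |(A.w e : ℝ)| ≤ M := by
  obtain ⟨M, hM⟩ := (Set.finite_range fun e => |(A.w e : ℝ)|).bddAbove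
  exact ⟨M, fun e => hM ⟨e, rfl⟩⟩

lemma confs_add (c : Config Q Γ) (f : ℕ → Edge Q Γ) (i k : ℕ) :
    confs c f (i + k) = confs (confs c f i) (fun j => f (i + j)) k := by
  induction k with
  | zero => rfl
  | succ k ih => rw [← add_assoc]; simp only [confs, ih]

lemma confs_congr {f g : ℕ → Edge Q Γ} (c : Config Q Γ) {n : ℕ} (h : ∀ k < n, f k = g k) :
    confs c f n = confs c g n := by
  induction n with
  | zero => rfl
  | succ n ih =>
    simp only [confs]
    rw [ih fun k hk => h k (by omega), h n (by omega)]

/-- If a path from `(γβ₀, q)` never exposes `β₀`, then `β₀` may be replaced by any other stack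
content. -/
lemma confs_replace_bottom {γ : Γ} {β₀ : List Γ} {q : Q} {f : ℕ → Edge Q Γ}
    (h : ∀ k, β₀.length < height (confs (γ :: β₀, q) f k)) (k : ℕ) :
    ∃ σ, σ ≠ [] ∧ ∃ q', ∀ β, confs (γ :: β, q) f k = (σ ++ β, q') := by
  induction k with
  | zero => exact ⟨[γ], by simp, q, fun β => rfl⟩
  | succ k ih =>
    obtain ⟨σ, hσ, q', hq'⟩ := ih
    have hk := h (k + 1)
    simp only [confs, hq', next, height] at hk
    simp only [confs, hq', next]
    cases hc : (f k).com with
    | skip => exact ⟨σ, hσ, _, fun β => rfl⟩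
    | push z => exact ⟨z :: σ, by simp, _, fun β => rfl⟩
    | pop =>
      refine ⟨σ.tail, ?_, (f k).q2, fun β => ?_⟩
      · intro h0
        obtain ⟨x, xs, rfl⟩ := List.exists_cons_of_ne_nil hσ
        simp only [List.tail_cons] at h0
        simp [hc, Com.apply, h0] at hk
      · simp [Com.apply, List.tail_append_of_ne_nil hσ]

/-- The first `l > 0` edges of `g` form a valid path from `(γβ, q)` back to state `q` and top
symbol `γ`, whatever the stack content `β` is. -/
def WPS.IsCycle (A : WPS Q Γ) (v : Q × Γ) (l : ℕ) (g : ℕ → Edge Q Γ) : Prop :=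
  0 < l ∧ ∀ β, (∀ k < l, A.Enabled (confs (v.2 :: β, v.1) g k) (g k)) ∧
    ∃ β', confs (v.2 :: β, v.1) g l = (v.2 :: β', v.1)

/-- A configuration with state and top symbol `v` is reached from the initial configuration by
the first `l > 0` edges of `g`. -/
def WPS.IsReach (A : WPS Q Γ) (v : Q × Γ) (l : ℕ) (g : ℕ → Edge Q Γ) : Prop :=
  0 < l ∧ (∀ k < l, A.Enabled (confs A.start g k) (g k)) ∧
    ∃ β, confs A.start g l = (v.2 :: β, v.1)

lemma WPS.Enabled.replace_bottom {A : WPS Q Γ} {σ β₀ : List Γ} {q : Q} {e : Edge Q Γ}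
    (hσ : σ ≠ []) (h : A.Enabled (σ ++ β₀, q) e) (β : List Γ) : A.Enabled (σ ++ β, q) e := by
  obtain ⟨x, xs, rfl⟩ := List.exists_cons_of_ne_nil hσ
  simpa [WPS.Enabled] using h

lemma WPS.Enabled.eq_cons {A : WPS Q Γ} {c : Config Q Γ} {e : Edge Q Γ} (h : A.Enabled c e) :
    ∃ β, c = (e.top :: β, e.q1) := by
  obtain ⟨α, q⟩ := c
  obtain ⟨-, h1, h2⟩ := h
  obtain ⟨β, hβ⟩ := List.head?_eq_some_iff.1 h2
  exact ⟨β, Prod.ext hβ h1⟩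

/-- The part of an infinite path from a local minimum to a later position with the same state and
top symbol is a cycle. -/
lemma isCycle_of_tail_min {A : WPS Q Γ} {f : ℕ → Edge Q Γ} {c : Config Q Γ}
    (hf : A.ValidInf c f) {i j : ℕ} (hij : i < j)
    (hmin : ∀ k ≥ i, height (confs c f i) ≤ height (confs c f k)) {v : Q × Γ}
    (hi : ((f i).q1, (f i).top) = v) (hj : ((f j).q1, (f j).top) = v) :
    A.IsCycle v (j - i) (fun k => f (i + k)) := by
  subst hi
  obtain ⟨β₀, hβ₀⟩ := (hf i).eq_cons
  have hadd : ∀ k, confs ((f i).top :: β₀, (f i).q1) (fun k => f (i + k)) k =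
      confs c f (i + k) := fun k => by rw [← hβ₀, ← confs_add]
  have hrep := confs_replace_bottom (γ := (f i).top) (β₀ := β₀) (q := (f i).q1)
    (f := fun k => f (i + k)) fun k => by
      have := hmin (i + k) (by omega)
      rw [hβ₀] at this
      rw [hadd]
      exact this
  have hen : ∀ k β, A.Enabled (confs ((f i).top :: β, (f i).q1) (fun k => f (i + k)) k)
      (f (i + k)) := by
    intro k β
    obtain ⟨σ, hσ, q', hq'⟩ := hrep k
    have h1 := hf (i + k)
    rw [← hadd, hq'] at h1
    rw [hq']
    exact h1.replace_bottom hσ β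
  refine ⟨by omega, fun β => ⟨fun k _ => hen k β, ?_⟩⟩
  obtain ⟨β', hβ'⟩ := (hen (j - i) β).eq_cons
  rw [Nat.add_sub_cancel' hij.le] at hβ'
  simp only [Prod.mk.injEq] at hj
  exact ⟨β', by rw [hβ', hj.1, hj.2]⟩

lemma abs_avgPref_le {A : WPS Q Γ} {M : ℝ} (hM : ∀ e, |(A.w e : ℝ)| ≤ M) (f : ℕ → Edge Q Γ)
    (n : ℕ) : |avgPref A f n| ≤ M := by
  have hn : (0 : ℝ) < n + 1 := by positivity
  rw [avgPref, abs_div, abs_of_pos hn, div_le_iff₀ hn]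
  refine (Finset.abs_sum_le_sum_abs _ _).trans ?_
  have := Finset.sum_le_card_nsmul (Finset.range (n + 1)) (fun i => |(A.w (f i) : ℝ)|) M
    fun i _ => hM _
  simp only [Finset.card_range, nsmul_eq_mul] at this
  push_cast at this
  linarith

/-- A path whose limit-inf average exceeds `-ε` yields a reachable cycle whose average exceeds
`-ε`. -/
lemma exists_cycle_of_lt_LimInfAvg [Finite Q] [Finite Γ] {A : WPS Q Γ} {f : ℕ → Edge Q Γ}
    (hf : A.ValidInf A.start f) {ε : ℝ} (hε : -ε < LimInfAvg A f) :
    ∃ v : Q × Γ, (∃ l g, A.IsReach v l g) ∧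
      ∃ l g, A.IsCycle v l g ∧ -(ε * l) < ∑ k ∈ Finset.range l, (A.w (g k) : ℝ) := by
  obtain ⟨M, hM⟩ := A.exists_weight_bound
  have hfreq : ∃ᶠ i in Filter.atTop,
      ∀ j ≥ i, height (confs A.start f i) ≤ height (confs A.start f j) :=
    Filter.frequently_atTop.2 (exists_tail_min _)
  obtain ⟨v, hv⟩ := frequently_fiber (r := fun i v =>
    (∀ j ≥ i, height (confs A.start f i) ≤ height (confs A.start f j)) ∧
      ((f i).q1, (f i).top) = v) hfreq fun n hn => ⟨_, hn, rfl⟩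
  obtain ⟨i, hi1, himin, hiv⟩ := Filter.frequently_atTop.1 hv 1
  refine ⟨v, ⟨i, f, hi1, fun k _ => hf k, ?_⟩, ?_⟩
  · obtain ⟨β, hβ⟩ := (hf i).eq_cons
    exact ⟨β, by rw [hβ, ← hiv]⟩
  by_contra! hcon
  obtain ⟨c, hc1, hc2⟩ := exists_between hε
  have hev : ∀ᶠ n in Filter.atTop, c < avgPref A f n :=
    Filter.eventually_lt_of_lt_liminf hc2
      (Filter.isBoundedUnder_of ⟨-M, fun n => (abs_le.1 (abs_avgPref_le hM f n)).1⟩)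
  obtain ⟨N, hN⟩ := Filter.eventually_atTop.1 hev
  set S : ℕ → ℝ := fun n => ∑ k ∈ Finset.range n, (A.w (f k) : ℝ) with hS
  obtain ⟨R, hR⟩ := exists_nat_gt ((S i + ε * i) / (c + ε))
  obtain ⟨j, hj, -, hjv⟩ := Filter.frequently_atTop.1 hv (max (max (N + 1) (i + 1)) R)
  simp only [max_le_iff] at hj
  obtain ⟨⟨hjN, hji⟩, hjR⟩ := hj
  have h1 := hcon _ _ (isCycle_of_tail_min hf (by omega) himin hiv hjv)
  have h2 : S j = S i + ∑ k ∈ Finset.range (j - i), (A.w (f (i + k)) : ℝ) := by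
    rw [hS]
    simp only
    rw [← Finset.sum_range_add, Nat.add_sub_cancel' (by omega)]
  have h3 := hN (j - 1) (by omega)
  obtain ⟨j, rfl⟩ : ∃ j', j = j' + 1 := ⟨j - 1, by omega⟩
  rw [Nat.add_sub_cancel, avgPref, lt_div_iff₀ (by positivity)] at h3
  rw [Nat.cast_sub (by omega)] at h1
  rw [div_lt_iff₀ (by linarith)] at hR
  have h4 : (R : ℝ) * (c + ε) ≤ ((j + 1 : ℕ) : ℝ) * (c + ε) :=
    mul_le_mul_of_nonneg_right (by exact_mod_cast hjR) (by linarith)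
  change c * (j + 1) < S (j + 1) at h3
  push_cast at h1 h4
  linarith

/-- A path reaching `v`, followed by cycles at `v`, is a valid infinite path. -/
lemma validInf_concat {A : WPS Q Γ} {v : Q × Γ} {l : ℕ → ℕ} {g : ℕ → ℕ → Edge Q Γ}
    (h0 : A.IsReach v (l 0) (g 0)) (hcyc : ∀ n, A.IsCycle v (l (n + 1)) (g (n + 1)))
    {F : ℕ → Edge Q Γ}
    (hF : ∀ n s, s < l n → F ((∑ i ∈ Finset.range n, l i) + s) = g n s) :
    A.ValidInf A.start F := by
  have hl : ∀ n, 0 < l n := fun n => by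
    cases n with
    | zero => exact h0.1
    | succ n => exact (hcyc n).1
  have hconf : ∀ n s, s ≤ l n → confs A.start F ((∑ i ∈ Finset.range n, l i) + s) =
      confs (confs A.start F (∑ i ∈ Finset.range n, l i)) (g n) s := fun n s hs => by
    rw [confs_add]
    exact confs_congr _ fun k hk => hF n k (by omega)
  have hend : ∀ n, ∃ β, confs A.start F (∑ i ∈ Finset.range (n + 1), l i) =
      (v.2 :: β, v.1) := by
    intro n
    rw [Finset.sum_range_succ, hconf _ _ le_rfl]
    induction n with
    | zero => exact h0.2.2
    | succ n ih =>
      obtain ⟨β, hβ⟩ := ih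
      rw [Finset.sum_range_succ, hconf _ _ le_rfl, hβ]
      exact ((hcyc n).2 β).2
  intro k
  obtain ⟨n, s, hs, rfl⟩ := exists_block l hl k
  rw [hconf n s hs.le, hF n s hs]
  cases n with
  | zero => exact h0.2.1 s hs
  | succ n =>
    obtain ⟨β, hβ⟩ := hend n
    rw [hβ]
    exact ((hcyc n).2 β).1 s hs

lemma LimInfAvg_nonneg {A : WPS Q Γ} {M : ℝ} (hM : ∀ e, |(A.w e : ℝ)| ≤ M) {f : ℕ → Edge Q Γ}
    (h : ∀ ε : ℝ, 0 < ε → ∃ K : ℝ, ∀ t : ℕ,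
      -K - ε * t ≤ ∑ k ∈ Finset.range t, (A.w (f k) : ℝ)) : 0 ≤ LimInfAvg A f := by
  refine le_of_forall_pos_le_add fun ε hε => ?_
  obtain ⟨K, hK⟩ := h (ε / 2) (by positivity)
  obtain ⟨R, hR⟩ := exists_nat_gt (K / (ε / 2))
  rw [div_lt_iff₀ (by positivity)] at hR
  suffices -ε ≤ LimInfAvg A f by linarith
  refine Filter.le_liminf_of_le (Filter.IsBoundedUnder.isCoboundedUnder_ge
    (Filter.isBoundedUnder_of ⟨M, fun n => (abs_le.1 (abs_avgPref_le hM f n)).2⟩)) ?_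
  filter_upwards [Filter.eventually_ge_atTop R] with n hn
  rw [avgPref, le_div_iff₀ (by positivity)]
  have h1 := hK (n + 1)
  have h2 : (R : ℝ) * (ε / 2) ≤ n * (ε / 2) := by gcongr
  push_cast at h1
  linarith

/-- A reachable `v` with cycles of average arbitrarily close to `0` from below yields a path with
nonnegative limit-inf average. -/
lemma exists_path_of_cycles [Finite Q] [Finite Γ] {A : WPS Q Γ} {v : Q × Γ}
    (hreach : ∃ l g, A.IsReach v l g)
    (hcyc : ∀ n : ℕ, ∃ l g, A.IsCycle v l g ∧
      -(1 / ((n : ℝ) + 1) * l) < ∑ k ∈ Finset.range l, (A.w (g k) : ℝ)) :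
    ∃ f, A.ValidInf A.start f ∧ 0 ≤ LimInfAvg A f := by
  obtain ⟨M, hM⟩ := A.exists_weight_bound
  obtain ⟨l₀, g₀, h₀⟩ := hreach
  choose lc gc hc hw using hcyc
  obtain ⟨m, hm, hmtop⟩ := exists_slow_reindex fun k => (k + 1) * lc k
  let l : ℕ → ℕ := fun n => Nat.casesOn n l₀ fun n => lc (m n)
  let g : ℕ → ℕ → Edge Q Γ := fun n => Nat.casesOn n g₀ fun n => gc (m n)
  have hl : ∀ n, 0 < l n := fun n => by
    cases n with
    | zero => exact h₀.1
    | succ n => exact (hc (m n)).1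
  obtain ⟨F, hF⟩ := exists_concat l hl g
  refine ⟨F, validInf_concat (l := l) (g := g) h₀ (fun n => hc (m n)) hF,
    LimInfAvg_nonneg hM fun ε hε => ?_⟩
  refine exists_sum_lower_bound (fun k => hM (F k)) (G := ((0 + 1) * lc 0 : ℕ)) (by positivity) hl
    (fun η hη => ?_) hε
  obtain ⟨K, hK⟩ := exists_nat_gt (1 / η)
  obtain ⟨N, hN⟩ := hmtop K
  refine ⟨N + 1, fun n hn => ?_⟩
  obtain ⟨n, rfl⟩ : ∃ n', n = n' + 1 := ⟨n - 1, by omega⟩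
  have hmn : 1 / ((m n : ℝ) + 1) ≤ η := by
    have h1 : (K : ℝ) ≤ m n := by exact_mod_cast hN n (by omega)
    rw [div_le_comm₀ (by positivity) hη]
    linarith
  constructor
  · rw [Finset.sum_congr rfl fun s hs => by rw [hF (n + 1) s (Finset.mem_range.1 hs)]]
    change -(η * (lc (m n) : ℝ)) ≤ ∑ s ∈ Finset.range (lc (m n)), (A.w (gc (m n) s) : ℝ)
    have h1 : 1 / ((m n : ℝ) + 1) * lc (m n) ≤ η * lc (m n) := by gcongr
    linarith [hw (m n)]
  · change (lc (m n) : ℝ) ≤ _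
    have h1 : ((m n : ℝ) + 1) * lc (m n) ≤ n + ((0 + 1) * lc 0 : ℕ) := by exact_mod_cast hm n
    calc (lc (m n) : ℝ) = 1 / ((m n : ℝ) + 1) * (((m n : ℝ) + 1) * lc (m n)) := by field_simp
      _ ≤ η * (((n + 1 : ℕ) : ℝ) + ((0 + 1) * lc 0 : ℕ)) := by
        refine mul_le_mul hmn (h1.trans ?_) (by positivity) hη.le
        push_cast
        linarith

end Paths

end PDS

open PDS in
/-- there is an infinite path from the initial configuration with
liminf-average at least `0` iff for every `ε > 0` there is one with liminf-average
greater than `-ε`. -/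
theorem nonstrict_mean_payoff_iff_all_epsilon
    {Q Γ : Type} [Fintype Q] [Fintype Γ] (A : WPS Q Γ) :
    (∃ f : ℕ → Edge Q Γ, A.ValidInf A.start f ∧ 0 ≤ LimInfAvg A f) ↔
      (∀ ε : ℝ, 0 < ε → ∃ f : ℕ → Edge Q Γ, A.ValidInf A.start f ∧ -ε < LimInfAvg A f) := by
  refine ⟨fun ⟨f, hf, h0⟩ ε hε => ⟨f, hf, by linarith⟩, fun h => ?_⟩
  have hn : ∀ n : ℕ, ∃ v : Q × Γ, (∃ l g, A.IsReach v l g) ∧ ∃ l g, A.IsCycle v l g ∧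
      -(1 / ((n : ℝ) + 1) * l) < ∑ k ∈ Finset.range l, (A.w (g k) : ℝ) := fun n => by
    obtain ⟨f, hf, hlt⟩ := h (1 / ((n : ℝ) + 1)) (by positivity)
    exact exists_cycle_of_lt_LimInfAvg hf hlt
  obtain ⟨v, hv⟩ := frequently_fiber (p := fun _ => True)
    (Filter.Frequently.of_forall fun _ => trivial)
    fun n _ => hn n
  refine exists_path_of_cycles (v := v) ?_ fun n => ?_
  · obtain ⟨n, hr, -⟩ := hv.exists
    exact hr
  · obtain ⟨n', hle, -, l, g, hc, hw⟩ := Filter.frequently_atTop.1 hv n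
    refine ⟨l, g, hc, lt_of_le_of_lt ?_ hw⟩
    have h1 : 1 / ((n' : ℝ) + 1) ≤ 1 / ((n : ℝ) + 1) :=
      one_div_le_one_div_of_le (by positivity) (by exact_mod_cast Nat.succ_le_succ hle)
    have h2 : 1 / ((n' : ℝ) + 1) * (l : ℝ) ≤ 1 / ((n : ℝ) + 1) * l := by gcongr
    linarith
end

section
/- There exists a weighted pushdown system A such that there exists an infinite valid path π from the initial configuration with LimInfAvg(π) = 0, but every ultimately periodic infinite valid path π' of A satisfies both LimInfAvg(π') < 0 and LimSupAvg(π') < 0. Concretely, one may take A with states Q = {q₁, q₂} (initial state q₁), stack alphabet Γ = {⊥, γ}, and edges e₁ = (q₁,⊥,q₁,push(γ)), e₂ = (q₁,γ,q₁,push(γ)), e₃ = (q₁,γ,q₂,skip), e₄ = (q₂,γ,q₂,pop), e₅ = (q₂,⊥,q₁,skip), with weights w(e₄) = 1 and w(e₁) = w(e₂) = w(e₃) = w(e₅) = −1. -/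
open scoped BigOperators

namespace PDS

/-- The edges of the example WPS: states `Fin 2` (`0 = q₁`, `1 = q₂`), stack alphabet
`Fin 2` (`0 = ⊥`, `1 = γ`). -/
def exE : Set (Edge (Fin 2) (Fin 2)) :=
  {⟨0, 0, 0, .push 1⟩, ⟨0, 1, 0, .push 1⟩, ⟨0, 1, 1, .skip⟩, ⟨1, 1, 1, .pop⟩,
    ⟨1, 0, 0, .skip⟩}

/-- The weight function of the example WPS: `w(e₄) = 1`, all other weights `-1`. -/
def exW : Edge (Fin 2) (Fin 2) → ℤ :=
  fun e => if e = ⟨1, 1, 1, .pop⟩ then 1 else -1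

/-- The example WPS of the paper. -/
def exA : WPS (Fin 2) (Fin 2) where
  q0 := 0
  bot := 0
  E := exE
  w := exW
  no_push_bot := by
    intro e he
    simp only [exE, Set.mem_insert_iff, Set.mem_singleton_iff] at he
    rcases he with rfl | rfl | rfl | rfl | rfl <;> decide
  no_pop_bot := by
    intro e he
    simp only [exE, Set.mem_insert_iff, Set.mem_singleton_iff] at he
    rcases he with rfl | rfl | rfl | rfl | rfl <;> decide

end PDS

namespace ExampleWPS

open PDS Filter Topology

/-! ### Ultimately periodic sequences -/

/-- If the increments of a sequence are periodic from `N` on, then so is its increment over a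
whole period. -/
lemma add_period_sub_eq {G : Type*} [AddCommGroup G] {s : ℕ → G} {N p : ℕ}
    (h : ∀ n, N ≤ n → s (n + p + 1) - s (n + p) = s (n + 1) - s n) (n : ℕ) (hn : N ≤ n) :
    s (n + p) - s n = s (N + p) - s N := by
  induction n, hn using Nat.le_induction with
  | base => rfl
  | succ n hn ih =>
    rw [← ih, sub_eq_sub_iff_sub_eq_sub, show n + 1 + p = n + p + 1 by omega]
    exact h n hn

/-- An ultimately periodic real sequence is bounded. -/
lemma exists_abs_le_of_periodic {g : ℕ → ℝ} {N p : ℕ} (hp : 0 < p)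
    (h : ∀ n, N ≤ n → g (n + p) = g n) : ∃ C, ∀ n, |g n| ≤ C := by
  refine ⟨∑ i ∈ Finset.range (N + p), |g i|, fun n => ?_⟩
  induction n using Nat.strong_induction_on with
  | _ n ih =>
    by_cases hn : n < N + p
    · exact Finset.single_le_sum (f := fun i => |g i|) (fun i _ => abs_nonneg _)
        (Finset.mem_range.2 hn)
    · have h1 := h (n - p) (by omega)
      rw [Nat.sub_add_cancel (by omega)] at h1
      rw [h1]
      exact ih _ (by omega)

/-- If a sequence increases by `W` over every period of length `p` from some point on, then
its averages converge to `W / p`. -/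
lemma tendsto_div_of_period {s : ℕ → ℝ} {N p : ℕ} {W : ℝ} (hp : 0 < p)
    (h : ∀ n, N ≤ n → s (n + p) - s n = W) :
    Tendsto (fun n : ℕ => s (n + 1) / (n + 1)) atTop (𝓝 (W / p)) := by
  have hp' : (p : ℝ) ≠ 0 := by positivity
  obtain ⟨C, hC⟩ := exists_abs_le_of_periodic (g := fun n => s n - n * (W / p)) hp
    (fun n hn => by
      have := h n hn
      push_cast
      field_simp
      linear_combination p * this)
  have h0 : Tendsto (fun n : ℕ => (s (n + 1) - (n + 1 : ℕ) * (W / p)) / (n + 1 : ℝ))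
      atTop (𝓝 0) := by
    refine squeeze_zero_norm (a := fun n : ℕ => C * (1 / ((n : ℝ) + 1))) (fun n => ?_) ?_
    · rw [Real.norm_eq_abs, abs_div, abs_of_pos (by positivity : (0 : ℝ) < n + 1),
        mul_one_div]
      gcongr
      exact hC (n + 1)
    · simpa using tendsto_one_div_add_atTop_nhds_zero_nat.const_mul C
  have h1 := h0.add_const (W / p)
  rw [zero_add] at h1
  refine h1.congr fun n => ?_
  have : (n : ℝ) + 1 ≠ 0 := by positivity
  push_cast
  field_simp
  ring

/-! ### Weights and stack heights in the example system -/

/-- Total weight of the first `n` edges. -/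
def prefixWt (f : ℕ → Edge (Fin 2) (Fin 2)) (n : ℕ) : ℤ :=
  ∑ i ∈ Finset.range n, exW (f i)

lemma prefixWt_succ (f : ℕ → Edge (Fin 2) (Fin 2)) (n : ℕ) :
    prefixWt f (n + 1) = prefixWt f n + exW (f n) :=
  Finset.sum_range_succ _ _

lemma avgPref_eq (f : ℕ → Edge (Fin 2) (Fin 2)) (n : ℕ) :
    avgPref exA f n = (prefixWt f (n + 1) : ℝ) / (n + 1) := by
  simp [avgPref, prefixWt, exA]

/-- Effect of a stack command on the stack height. -/
def heightChange : Com (Fin 2) → ℤ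
  | .skip => 0
  | .pop => -1
  | .push _ => 1

lemma height_next {c : Config (Fin 2) (Fin 2)} (hc : c.1 ≠ []) (e : Edge (Fin 2) (Fin 2)) :
    (height (next c e) : ℤ) = height c + heightChange e.com := by
  obtain ⟨_ | ⟨a, l⟩, q⟩ := c
  · exact absurd rfl hc
  · obtain ⟨q1, t, q2, com⟩ := e
    cases com <;> simp [height, next, Com.apply, heightChange]

/-- Every edge of the example either pushes in state `0`, or pops in state `1`, or skips. -/
lemma edge_cases {e : Edge (Fin 2) (Fin 2)} (he : e ∈ exE) :
    (e.q1 = 0 ∧ e.q2 = 0 ∧ heightChange e.com = 1 ∧ exW e = -1) ∨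
    (e.q1 = 1 ∧ e.q2 = 1 ∧ heightChange e.com = -1 ∧ exW e = 1) ∨
    (heightChange e.com = 0 ∧ exW e = -1) := by
  simp only [exE, Set.mem_insert_iff, Set.mem_singleton_iff] at he
  rcases he with rfl | rfl | rfl | rfl | rfl <;> simp [heightChange, exW]

section Path

variable {f : ℕ → Edge (Fin 2) (Fin 2)}

lemma stack_ne_nil (hf : exA.ValidInf exA.start f) (n : ℕ) :
    (confs exA.start f n).1 ≠ [] := by
  intro h
  have := (hf n).2.2
  simp [h] at this

lemma height_pos (hf : exA.ValidInf exA.start f) (n : ℕ) :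
    0 < height (confs exA.start f n) :=
  List.length_pos_iff.2 (stack_ne_nil hf n)

lemma height_confs_succ (hf : exA.ValidInf exA.start f) (n : ℕ) :
    (height (confs exA.start f (n + 1)) : ℤ) =
      height (confs exA.start f n) + heightChange (f n).com :=
  height_next (stack_ne_nil hf n) _

lemma q1_succ (hf : exA.ValidInf exA.start f) (n : ℕ) : (f (n + 1)).q1 = (f n).q2 :=
  (hf (n + 1)).2.1.symm

/-- The sum of weight and stack height never increases along a path. -/
lemma antitone_wt_add_height (hf : exA.ValidInf exA.start f) :
    Antitone fun n => prefixWt f n + height (confs exA.start f n) := by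
  refine antitone_nat_of_succ_le fun n => ?_
  rw [prefixWt_succ, height_confs_succ hf]
  rcases edge_cases (hf n).1 with h | h | h <;> omega

/-- Along a path segment on which weight plus height is constant, the path either only pushes
or only pops. -/
lemma push_or_pop_of_eq (hf : exA.ValidInf exA.start f) {N p : ℕ}
    (h : prefixWt f N + height (confs exA.start f N) ≤
      prefixWt f (N + p) + height (confs exA.start f (N + p))) :
    prefixWt f (N + p) = prefixWt f N - p ∨
      (height (confs exA.start f (N + p)) : ℤ) = height (confs exA.start f N) - p := by
  have hanti := antitone_wt_add_height hf
  have hconst : ∀ i ≤ p, prefixWt f (N + i) + height (confs exA.start f (N + i)) =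
      prefixWt f N + height (confs exA.start f N) := fun i hi =>
    le_antisymm (hanti (Nat.le_add_right N i)) (h.trans (hanti (by omega)))
  have key : ∀ i ≤ p,
      ((f N).q1 = 0 → (i < p → (f (N + i)).q1 = 0) ∧ prefixWt f (N + i) = prefixWt f N - i) ∧
      ((f N).q1 = 1 → (i < p → (f (N + i)).q1 = 1) ∧
        (height (confs exA.start f (N + i)) : ℤ) = height (confs exA.start f N) - i) := by
    intro i
    induction i with
    | zero => simp +contextual
    | succ i ih =>
      intro hi
      have hc := hconst (i + 1) hi
      have hc' := hconst i (by omega)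
      have hq := q1_succ hf (N + i)
      have hw := prefixWt_succ f (N + i)
      have hh := height_confs_succ hf (N + i)
      obtain ⟨ih0, ih1⟩ := ih (by omega)
      rw [← Nat.add_assoc] at *
      constructor
      · intro h0
        obtain ⟨a, b⟩ := ih0 h0
        have a := a (by omega)
        rcases edge_cases (hf (N + i)).1 with h | h | h
        · exact ⟨fun _ => hq.trans h.2.1, by push_cast; omega⟩
        · simp [a] at h
        · omega
      · intro h0
        obtain ⟨a, b⟩ := ih1 h0
        have a := a (by omega)
        rcases edge_cases (hf (N + i)).1 with h | h | h
        · simp [a] at h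
        · exact ⟨fun _ => hq.trans h.2.1, by push_cast; omega⟩
        · omega
  obtain ⟨k0, k1⟩ := key p le_rfl
  rcases (show (f N).q1 = 0 ∨ (f N).q1 = 1 by generalize (f N).q1 = q; revert q; decide)
    with h0 | h0
  · exact Or.inl (k0 h0).2
  · exact Or.inr (k1 h0).2

/-- The averages of an ultimately periodic path converge to a negative limit. -/
lemma exists_neg_tendsto_avgPref (hf : exA.ValidInf exA.start f) (hper : UltPeriodic f) :
    ∃ l < 0, Tendsto (avgPref exA f) atTop (𝓝 l) := by
  obtain ⟨N, p, hp, hper⟩ := hper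
  have hW := add_period_sub_eq (s := prefixWt f) (N := N) (p := p) (fun n hn => by
    simp [prefixWt_succ, hper n hn])
  have hD := add_period_sub_eq (s := fun n => (height (confs exA.start f n) : ℤ))
    (N := N) (p := p) (fun n hn => by simp [height_confs_succ hf, hper n hn])
  set W := prefixWt f (N + p) - prefixWt f N with hWdef
  set D : ℤ := height (confs exA.start f (N + p)) - height (confs exA.start f N) with hDdef
  have hmul : ∀ m : ℕ, (height (confs exA.start f (N + m * p)) : ℤ) =
      height (confs exA.start f N) + m * D := by
    intro m
    induction m with
    | zero => simp
    | succ m ih =>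
      have := hD (N + m * p) (by omega)
      rw [show N + (m + 1) * p = N + m * p + p by ring]
      push_cast
      linear_combination this + ih
  have hD0 : 0 ≤ D := by
    by_contra! hneg
    have h1 := hmul (height (confs exA.start f N))
    have h2 := height_pos hf (N + height (confs exA.start f N) * p)
    nlinarith
  have hWneg : W < 0 := by
    by_contra! hnn
    rcases push_or_pop_of_eq hf (N := N) (p := p) (by omega) with h | h <;> omega
  refine ⟨W / p, div_neg_of_neg_of_pos (by exact_mod_cast hWneg) (by positivity), ?_⟩
  have := tendsto_div_of_period (s := fun n => (prefixWt f n : ℝ)) (W := W) hp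
    (fun n hn => by exact_mod_cast hW n hn)
  exact this.congr fun n => (avgPref_eq f n).symm

end Path

/-! ### A path whose averages tend to zero -/

/-- Bookkeeping data for the path that climbs to height `1`, descends, climbs to height `2`,
descends, and so on. -/
structure Saw where
  /-- The number of completed teeth. -/
  teeth : ℕ
  /-- The number of symbols above the bottom of the stack. -/
  level : ℕ
  /-- Whether the current tooth is being descended. -/
  down : Bool

/-- The edge taken next. -/
def Saw.edge (s : Saw) : Edge (Fin 2) (Fin 2) :=
  if s.down then
    if s.level = 0 then ⟨1, 0, 0, .skip⟩ else ⟨1, 1, 1, .pop⟩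
  else if s.level = 0 then ⟨0, 0, 0, .push 1⟩
  else if s.level ≤ s.teeth then ⟨0, 1, 0, .push 1⟩ else ⟨0, 1, 1, .skip⟩

/-- The data after taking `Saw.edge`. -/
def Saw.step (s : Saw) : Saw :=
  if s.down then
    if s.level = 0 then ⟨s.teeth + 1, 0, false⟩ else ⟨s.teeth, s.level - 1, true⟩
  else if s.level ≤ s.teeth then ⟨s.teeth, s.level + 1, false⟩ else ⟨s.teeth, s.level, true⟩

/-- The configuration described by the data. -/
def Saw.config (s : Saw) : Config (Fin 2) (Fin 2) :=
  (List.replicate s.level 1 ++ [0], if s.down then 1 else 0)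

/-- The data after `n` steps. -/
def saw : ℕ → Saw
  | 0 => ⟨0, 0, false⟩
  | n + 1 => (saw n).step

/-- The edges of the sawtooth path. -/
def sawEdge (n : ℕ) : Edge (Fin 2) (Fin 2) := (saw n).edge

lemma Saw.enabled_edge (s : Saw) : exA.Enabled s.config s.edge := by
  obtain ⟨k, _ | h, _ | _⟩ := s
  · simp [WPS.Enabled, config, edge, exA, exE]
  · simp [WPS.Enabled, config, edge, exA, exE]
  · by_cases hk : h + 1 ≤ k <;>
      simp [WPS.Enabled, config, edge, exA, exE, hk, List.replicate_succ]
  · simp [WPS.Enabled, config, edge, exA, exE, List.replicate_succ]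

lemma Saw.next_config (s : Saw) : next s.config s.edge = s.step.config := by
  obtain ⟨k, _ | h, _ | _⟩ := s
  · simp [next, Com.apply, config, edge, step]
  · simp [next, Com.apply, config, edge, step]
  · by_cases hk : h + 1 ≤ k <;>
      simp [next, Com.apply, config, edge, step, hk, List.replicate_succ]
  · simp [next, Com.apply, config, edge, step, List.replicate_succ]

lemma confs_sawEdge (n : ℕ) : confs exA.start sawEdge n = (saw n).config := by
  induction n with
  | zero => simp [confs, saw, Saw.config, WPS.start, exA]
  | succ n ih => rw [confs, ih, sawEdge, Saw.next_config, saw]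

lemma validInf_sawEdge : exA.ValidInf exA.start sawEdge := fun n => by
  rw [confs_sawEdge]
  exact Saw.enabled_edge _

/-- Elapsed time as a function of the data. -/
def Saw.time (s : Saw) : ℤ :=
  s.teeth ^ 2 + 3 * s.teeth + if s.down then 2 * (s.teeth : ℤ) + 3 - s.level else (s.level : ℤ)

/-- Accumulated weight as a function of the data. -/
def Saw.weight (s : Saw) : ℤ := -s.level - 2 * s.teeth - if s.down then 1 else 0

lemma Saw.level_step_le {s : Saw} (h : s.level ≤ s.teeth + 1) :
    s.step.level ≤ s.step.teeth + 1 := by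
  unfold step
  split_ifs <;> simp <;> omega

lemma Saw.time_step {s : Saw} (hs : s.level ≤ s.teeth + 1) : s.step.time = s.time + 1 := by
  obtain ⟨k, _ | h, _ | _⟩ := s
  · simp [time, step]
  · simp [time, step]; ring
  · by_cases hk : h + 1 ≤ k
    · simp [time, step, hk]; ring
    · obtain rfl : h = k := by simp at hs; omega
      simp [time, step]; ring
  · simp [time, step]; ring

lemma Saw.weight_step (s : Saw) : s.step.weight = s.weight + exW s.edge := by
  obtain ⟨k, _ | h, _ | _⟩ := s
  · simp [weight, step, edge, exW]; ring
  · simp [weight, step, edge, exW]; ring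
  · by_cases hk : h + 1 ≤ k <;> simp [weight, step, edge, exW, hk] <;> ring
  · simp [weight, step, edge, exW]; ring

lemma saw_level_le (n : ℕ) : (saw n).level ≤ (saw n).teeth + 1 := by
  induction n with
  | zero => simp [saw]
  | succ n ih => exact Saw.level_step_le ih

lemma saw_time (n : ℕ) : (saw n).time = n := by
  induction n with
  | zero => simp [saw, Saw.time]
  | succ n ih => rw [saw, Saw.time_step (saw_level_le n), ih]; push_cast; rfl

lemma prefixWt_sawEdge (n : ℕ) : prefixWt sawEdge n = (saw n).weight := by
  induction n with
  | zero => simp [saw, Saw.weight, prefixWt]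
  | succ n ih => rw [prefixWt_succ, ih, saw, Saw.weight_step, sawEdge]

/-- The accumulated weight is of the order of the square root of the elapsed time. -/
lemma prefixWt_sawEdge_sq_le (n : ℕ) : prefixWt sawEdge n ^ 2 ≤ 9 * n + 9 := by
  rw [prefixWt_sawEdge, ← saw_time n]
  have hl := saw_level_le n
  generalize saw n = s at hl
  obtain ⟨k, h, _ | _⟩ := s
  all_goals
    simp only [Saw.weight, Saw.time] at hl ⊢
    have hl' : (h : ℤ) ≤ k + 1 := by exact_mod_cast hl
    have h0 : (0 : ℤ) ≤ h := by positivity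
    have k0 : (0 : ℤ) ≤ k := by positivity
    simp only [Bool.false_eq_true, if_true, if_false]
    nlinarith

lemma tendsto_avgPref_sawEdge : Tendsto (avgPref exA sawEdge) atTop (𝓝 0) := by
  refine squeeze_zero_norm (a := fun n : ℕ => √(18 * (1 / ((n : ℝ) + 1)))) (fun n => ?_) ?_
  · refine Real.le_sqrt_of_sq_le ?_
    have h : (prefixWt sawEdge (n + 1) : ℝ) ^ 2 ≤ 9 * (n + 1) + 9 := by
      exact_mod_cast prefixWt_sawEdge_sq_le (n + 1)
    rw [Real.norm_eq_abs, sq_abs, avgPref_eq, div_pow, mul_one_div, div_le_div_iff₀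
      (by positivity) (by positivity)]
    have hn : (0 : ℝ) ≤ n := by positivity
    have : (prefixWt sawEdge (n + 1) : ℝ) ^ 2 ≤ 18 * (n + 1) := by linarith
    nlinarith
  · simpa using (tendsto_one_div_add_atTop_nhds_zero_nat.const_mul (18 : ℝ)).sqrt

end ExampleWPS

open PDS in
/-- the concrete WPS `exA` has an infinite path from the initial
configuration with liminf-average `0`, yet every ultimately periodic infinite valid
path of it has negative liminf-average and negative limsup-average. -/
theorem ultimately_periodic_paths_do_not_suffice :
    (∃ f : ℕ → Edge (Fin 2) (Fin 2), exA.ValidInf exA.start f ∧ LimInfAvg exA f = 0) ∧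
    (∀ f : ℕ → Edge (Fin 2) (Fin 2), exA.ValidInf exA.start f → UltPeriodic f →
      LimInfAvg exA f < 0 ∧ LimSupAvg exA f < 0) := by
  refine ⟨⟨ExampleWPS.sawEdge, ExampleWPS.validInf_sawEdge, ?_⟩, fun f hf hper => ?_⟩
  · exact ExampleWPS.tendsto_avgPref_sawEdge.liminf_eq
  · obtain ⟨l, hl, hlim⟩ := ExampleWPS.exists_neg_tendsto_avgPref hf hper
    exact ⟨by rw [LimInfAvg, hlim.liminf_eq]; exact hl,
      by rw [LimSupAvg, hlim.limsup_eq]; exact hl⟩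
end
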